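/- Stationary-phase/integration-by-parts bound: let φ ∈ 𝒮(ℝ), x₀ ∈ ℝ, v > 0, 0 < t ≤ 1 with 2|x₀|/v ≤ t. Then the free Schrödinger evolution e^{−itH₀}[e^{ixv}φ(x − x₀)] restricted to x < 0 satisfies, for every integer k ≥ 0, ‖e^{−itH₀}[e^{i·v}φ(· − x₀)]·𝟙_{x<0}‖_{L²} ≤ c_k (tv)^{−k} Σ_{j=0}^{k} t^j ‖⟨x⟩^{k−j} φ‖_{H^j} ≤ c_k (tv)^{−k} ‖⟨x⟩^k φ‖_{H^k}, where c_k depends only on k. -/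

import Mathlib

open Complex MeasureTheory

open SchwartzMap FourierTransform LineDeriv
open scoped ContDiff

noncomputable section

/-- the weight `(1+x^2)^r` -/
def wt (r : ℝ) (x : ℝ) : ℝ := (1 + x ^ 2) ^ r

theorem wt_pos (r x : ℝ) : 0 < wt r x := Real.rpow_pos_of_pos (by positivity) r

theorem wt_growth (r : ℝ) : (wt r).HasTemperateGrowth := by
  have := Function.hasTemperateGrowth_one_add_norm_sq_rpow ℝ r
  have h : wt r = fun x : ℝ => (1 + ‖x‖ ^ 2) ^ r := by
    ext x; simp [wt]
  rw [h]; exact this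

theorem wt_mul (r s x : ℝ) : wt r x * wt s x = wt (r + s) x :=
  (Real.rpow_add (by positivity) r s).symm

theorem wt_zero (x : ℝ) : wt 0 x = 1 := by simp [wt]

theorem wt_mono {r s : ℝ} (h : r ≤ s) (x : ℝ) : wt r x ≤ wt s x :=
  Real.rpow_le_rpow_of_exponent_le (by nlinarith [sq_nonneg x]) h

theorem wt_half (x : ℝ) : |x| ≤ wt (1/2) x := by
  rw [wt, ← Real.sqrt_eq_rpow]
  exact Real.abs_le_sqrt (by linarith)

/-- multiplication by the weight -/
def W (r : ℝ) : SchwartzMap ℝ ℂ →L[ℝ] SchwartzMap ℝ ℂ := smulLeftCLM ℂ (wt r)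

theorem W_apply (r : ℝ) (f : SchwartzMap ℝ ℂ) (x : ℝ) : W r f x = (wt r x : ℂ) * f x := by
  rw [W, smulLeftCLM_apply_apply (wt_growth r)]; simp

theorem norm_W (r : ℝ) (f : SchwartzMap ℝ ℂ) (x : ℝ) : ‖W r f x‖ = wt r x * ‖f x‖ := by
  rw [W_apply, norm_mul, Complex.norm_real, Real.norm_of_nonneg (wt_pos r x).le]

/-- multiplication by x -/
def X : SchwartzMap ℝ ℂ →L[ℂ] SchwartzMap ℝ ℂ := smulLeftCLM ℂ (fun x : ℝ => (x : ℂ))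

theorem X_growth : (fun x : ℝ => (x : ℂ)).HasTemperateGrowth :=
  Function.Complex.hasTemperateGrowth_ofReal

theorem X_apply (f : SchwartzMap ℝ ℂ) (x : ℝ) : X f x = (x : ℂ) * f x := by
  rw [X, smulLeftCLM_apply_apply X_growth]; simp

/-- derivative -/
def D : SchwartzMap ℝ ℂ →L[ℂ] SchwartzMap ℝ ℂ := derivCLM ℂ ℂ

theorem D_apply (f : SchwartzMap ℝ ℂ) (x : ℝ) : D f x = deriv f x := rfl

theorem D_coe (f : SchwartzMap ℝ ℂ) : ⇑(D f) = deriv f := rfl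

theorem D_iter (i : ℕ) (f : SchwartzMap ℝ ℂ) : ⇑(D^[i] f) = iteratedDeriv i f := by
  induction i with
  | zero => simp
  | succ n ih => rw [Function.iterate_succ_apply', D_coe, ih, iteratedDeriv_succ]

theorem D_iter_add (i : ℕ) (f g : SchwartzMap ℝ ℂ) : D^[i] (f + g) = D^[i] f + D^[i] g := by
  induction i generalizing f g with
  | zero => simp
  | succ n ih => simp only [Function.iterate_succ_apply, map_add, ih]

theorem D_iter_smul (i : ℕ) (c : ℂ) (f : SchwartzMap ℝ ℂ) : D^[i] (c • f) = c • D^[i] f := by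
  induction i generalizing f with
  | zero => simp
  | succ n ih => simp only [Function.iterate_succ_apply, map_smul, ih]

theorem D_X (f : SchwartzMap ℝ ℂ) : D (X f) = X (D f) + f := by
  ext x
  have h : ⇑(X f) = fun x : ℝ => (x : ℂ) * f x := funext (X_apply f)
  have h1 : HasDerivAt (fun x : ℝ => (x : ℂ) * f x) (1 * f x + (x : ℂ) * deriv f x) x :=
    (HasDerivAt.ofReal_comp (hasDerivAt_id x)).mul (f.differentiableAt.hasDerivAt)
  rw [D_apply, h, h1.deriv, _root_.add_apply, X_apply, D_apply]
  ring

theorem D_iter_X (i : ℕ) (f : SchwartzMap ℝ ℂ) :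
    D^[i+1] (X f) = X (D^[i+1] f) + ((i + 1 : ℕ) : ℂ) • D^[i] f := by
  induction i generalizing f with
  | zero => simp [D_X]
  | succ n ih =>
    rw [Function.iterate_succ_apply, D_X, D_iter_add, ih]
    rw [← Function.iterate_succ_apply, ← Function.iterate_succ_apply]
    push_cast
    module

/-- L2 norm -/
def Nm (f : SchwartzMap ℝ ℂ) : ℝ := (eLpNorm f 2 volume).toReal

theorem Nm_nonneg (f : SchwartzMap ℝ ℂ) : 0 ≤ Nm f := ENNReal.toReal_nonneg

theorem Nm_le {ι : Type*} (s : Finset ι) (f : SchwartzMap ℝ ℂ) (g : ι → SchwartzMap ℝ ℂ) (C : ℝ)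
    (hC : 0 ≤ C) (h : ∀ x, ‖f x‖ ≤ C * ∑ i ∈ s, ‖g i x‖) : Nm f ≤ C * ∑ i ∈ s, Nm (g i) := by
  have h1 : eLpNorm f 2 volume ≤ ENNReal.ofReal C * ∑ i ∈ s, eLpNorm (g i) 2 volume := by
    refine (eLpNorm_le_mul_eLpNorm_of_ae_le_mul (g := fun x => ∑ i ∈ s, ‖g i x‖) (c := C)
      (Filter.Eventually.of_forall fun x => ?_) 2).trans ?_
    · rw [Real.norm_of_nonneg (Finset.sum_nonneg fun _ _ => norm_nonneg _)]
      exact h x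
    · gcongr
      have := eLpNorm_sum_le (μ := volume) (p := 2) (s := s) (f := fun i => fun x => ‖g i x‖)
        (fun i _ => (g i).continuous.norm.aestronglyMeasurable) (by norm_num)
      simp only [eLpNorm_norm] at this
      have he : (fun x => ∑ i ∈ s, ‖g i x‖) = ∑ i ∈ s, fun x => ‖g i x‖ := by
        funext x; rw [Finset.sum_apply]
      rw [he]
      exact this
  have hfin : ∀ i ∈ s, eLpNorm (g i) 2 volume ≠ ⊤ := fun i _ => ((g i).memLp 2 volume).2.ne
  have h2 := ENNReal.toReal_mono
    (ENNReal.mul_ne_top ENNReal.ofReal_ne_top (ENNReal.sum_ne_top.2 hfin)) h1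
  rw [ENNReal.toReal_mul, ENNReal.toReal_ofReal hC, ENNReal.toReal_sum hfin] at h2
  exact h2

theorem poly_bound (m : ℕ) (p : Polynomial ℝ) (hp : p.natDegree ≤ m) :
    ∃ C : ℝ, 0 ≤ C ∧ ∀ x : ℝ, |p.eval x| ≤ C * (1 + x ^ 2) ^ m := by
  refine ⟨∑ i ∈ Finset.range (m+1), |p.coeff i|, Finset.sum_nonneg fun _ _ => abs_nonneg _,
    fun x => ?_⟩
  rw [Polynomial.eval_eq_sum_range' (Nat.lt_succ_of_le hp), Finset.sum_mul]
  refine (Finset.abs_sum_le_sum_abs _ _).trans (Finset.sum_le_sum fun i hi => ?_)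
  rw [abs_mul, abs_pow]
  gcongr
  have h1 : |x| ≤ 1 + x ^ 2 := by nlinarith [sq_abs x, sq_nonneg (|x| - 1), abs_nonneg x]
  calc |x| ^ i ≤ (1 + x ^ 2) ^ i := by gcongr
    _ ≤ _ := pow_le_pow_right₀ (by nlinarith [sq_nonneg x]) (by simpa [Nat.lt_succ_iff] using hi)

theorem wt_hasDeriv (r x : ℝ) : HasDerivAt (wt r) (2 * r * x * wt (r - 1) x) x := by
  have h : HasDerivAt (fun x : ℝ => 1 + x ^ 2) (2 * x) x := by
    simpa using ((hasDerivAt_id x).pow 2).const_add 1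
  have := h.rpow_const (p := r) (Or.inl (by positivity))
  refine this.congr_deriv ?_
  rw [wt]; ring

theorem wt_iter (r : ℝ) (m : ℕ) : ∃ p : Polynomial ℝ, p.natDegree ≤ m ∧
    iteratedDeriv m (wt r) = fun x => p.eval x * wt (r - m) x := by
  induction m with
  | zero => exact ⟨1, by simp, by ext x; simp⟩
  | succ n ih =>
    obtain ⟨p, hp, h⟩ := ih
    refine ⟨Polynomial.derivative p * (1 + Polynomial.X ^ 2) +
      Polynomial.C (2 * (r - n)) * Polynomial.X * p, ?_, ?_⟩
    · refine Polynomial.natDegree_add_le_of_degree_le ?_ ?_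
      · by_cases h0 : n = 0
        · subst h0
          have : Polynomial.derivative p = 0 :=
            Polynomial.derivative_of_natDegree_zero (by omega)
          simp [this]
        · refine Polynomial.natDegree_mul_le.trans ?_
          have h1 := Polynomial.natDegree_derivative_le p
          have h2 : (1 + Polynomial.X ^ 2 : Polynomial ℝ).natDegree ≤ 2 := by compute_degree
          omega
      · refine Polynomial.natDegree_mul_le.trans ?_
        have h2 : (Polynomial.C (2 * (r - n)) * Polynomial.X : Polynomial ℝ).natDegree ≤ 1 := by
          compute_degree
        omega
    · rw [iteratedDeriv_succ, h]
      ext x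
      have hd : HasDerivAt (fun x => Polynomial.eval x p * wt (r - n) x) _ x :=
        (p.hasDerivAt x).mul (wt_hasDeriv _ x)
      rw [hd.deriv]
      have h3 : wt (r - n) x = (1 + x ^ 2) * wt (r - n - 1) x := by
        have := wt_mul 1 (r - n - 1) x
        rw [show 1 + (r - n - 1) = r - n by ring] at this
        rw [← this]; simp [wt]
      rw [h3]
      push_cast
      rw [show r - (n + 1) = r - n - 1 by ring]
      simp
      ring

theorem wt_iter_bound (r : ℝ) (m : ℕ) : ∃ C : ℝ, 0 ≤ C ∧
    ∀ x, ‖iteratedDeriv m (wt r) x‖ ≤ C * wt r x := by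
  obtain ⟨p, hp, h⟩ := wt_iter r m
  obtain ⟨C, hC, hb⟩ := poly_bound m p hp
  refine ⟨C, hC, fun x => ?_⟩
  rw [h]
  have h1 : wt r x = (1 + x ^ 2) ^ m * wt (r - m) x := by
    have := wt_mul m (r - m) x
    rw [show (m : ℝ) + (r - m) = r by ring] at this
    rw [← this]; simp [wt]
  rw [h1, norm_mul, Real.norm_of_nonneg (wt_pos _ _).le, ← mul_assoc]
  exact mul_le_mul_of_nonneg_right (hb x) (wt_pos _ _).le

theorem leibniz_bound (r : ℝ) (n : ℕ) : ∃ C : ℝ, 0 ≤ C ∧ ∀ (f : SchwartzMap ℝ ℂ) (x : ℝ),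
    ‖(D^[n] (W r f)) x‖ ≤ C * ∑ l ∈ Finset.range (n + 1), wt r x * ‖(D^[l] f) x‖ := by
  choose B hB0 hB using wt_iter_bound r
  refine ⟨∑ i ∈ Finset.range (n+1), n.choose i * B i,
    Finset.sum_nonneg fun i _ => mul_nonneg (by positivity) (hB0 i), fun f x => ?_⟩
  have hW : ⇑(W r f) = fun y => wt r y • f y := by ext y; simp [W_apply]
  rw [D_iter, hW, ← norm_iteratedFDeriv_eq_norm_iteratedDeriv]
  refine (norm_iteratedFDeriv_smul_le (N := ∞) (wt_growth r).1 (f.smooth ⊤) x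
    (by exact_mod_cast le_top)).trans ?_
  rw [Finset.sum_mul]
  refine Finset.sum_le_sum fun i hi => ?_
  rw [norm_iteratedFDeriv_eq_norm_iteratedDeriv, norm_iteratedFDeriv_eq_norm_iteratedDeriv,
    ← D_iter]
  have h1 : wt r x * ‖(D^[n - i] f) x‖ ≤
      ∑ l ∈ Finset.range (n + 1), wt r x * ‖(D^[l] f) x‖ :=
    Finset.single_le_sum (f := fun l => wt r x * ‖(D^[l] f) x‖)
      (fun l _ => mul_nonneg (wt_pos _ _).le (norm_nonneg _))
      (Finset.mem_range.2 (by omega))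
  calc (n.choose i : ℝ) * ‖iteratedDeriv i (wt r) x‖ * ‖(D^[n - i] f) x‖
      ≤ n.choose i * (B i * wt r x) * ‖(D^[n - i] f) x‖ := by gcongr; exact hB i x
    _ = n.choose i * B i * (wt r x * ‖(D^[n - i] f) x‖) := by ring
    _ ≤ _ := mul_le_mul_of_nonneg_left h1 (mul_nonneg (by positivity) (hB0 i))

theorem W_W (r s : ℝ) (f : SchwartzMap ℝ ℂ) : W r (W s f) = W (r + s) f := by
  ext x; rw [W_apply, W_apply, W_apply, ← wt_mul]; push_cast; ring

/-- weighted derivative versus derivative of the weighted function -/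
theorem use1 (a : ℝ) (n : ℕ) : ∃ C : ℝ, 0 ≤ C ∧ ∀ f : SchwartzMap ℝ ℂ,
    Nm (W a (D^[n] f)) ≤ C * ∑ l ∈ Finset.range (n + 1), Nm (D^[l] (W a f)) := by
  obtain ⟨C, hC, h⟩ := leibniz_bound (-a) n
  refine ⟨C, hC, fun f => Nm_le _ _ _ C hC fun x => ?_⟩
  have h1 := h (W a f) x
  have h2 : W (-a) (W a f) = f := by
    ext y; rw [W_W, W_apply]; simp [wt_zero]
  rw [h2] at h1
  rw [norm_W]
  refine (mul_le_mul_of_nonneg_left h1 (wt_pos a x).le).trans (le_of_eq ?_)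
  rw [← Finset.mul_sum]
  have h3 := wt_mul a (-a) x
  rw [add_neg_cancel, wt_zero] at h3
  linear_combination (C * ∑ l ∈ Finset.range (n + 1), ‖(D^[l] (W a f)) x‖) * h3

theorem use2 (a b : ℝ) (hab : a ≤ b) (n : ℕ) : ∃ C : ℝ, 0 ≤ C ∧ ∀ f : SchwartzMap ℝ ℂ,
    Nm (D^[n] (W a f)) ≤ C * ∑ l ∈ Finset.range (n + 1), Nm (D^[l] (W b f)) := by
  obtain ⟨C, hC, h⟩ := leibniz_bound (a - b) n
  refine ⟨C, hC, fun f => Nm_le _ _ _ C hC fun x => ?_⟩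
  have h1 := h (W b f) x
  rw [W_W, sub_add_cancel] at h1
  refine h1.trans ?_
  gcongr with l hl
  have : wt (a - b) x ≤ 1 := by
    rw [← wt_zero x]; exact wt_mono (by linarith) x
  exact mul_le_of_le_one_left (norm_nonneg _) this

/-- the conjugated position operator -/
def A (t : ℝ) (f : SchwartzMap ℝ ℂ) : SchwartzMap ℝ ℂ := X f + (-(I * t)) • D f

theorem step0 (t : ℝ) (ht : 0 ≤ t) (a : ℝ) (f : SchwartzMap ℝ ℂ) :
    Nm (W a (A t f)) ≤ Nm (W (a + 1/2) f) + t * Nm (W a (D f)) := by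
  have h := Nm_le (Finset.univ : Finset (Fin 2)) (W a (A t f))
    ![W (a + 1/2) f, (t : ℂ) • W a (D f)] 1 zero_le_one (fun x => ?_)
  · have h2 : Nm ((t : ℂ) • W a (D f)) ≤ t * Nm (W a (D f)) := by
      have := Nm_le (Finset.univ : Finset (Fin 1)) ((t : ℂ) • W a (D f)) ![W a (D f)] t ht
        (fun x => by simp [abs_of_nonneg ht])
      simpa using this
    simp only [Fin.sum_univ_two, Matrix.cons_val_zero, Matrix.cons_val_one, one_mul] at h
    linarith
  · simp only [Fin.sum_univ_two, Matrix.cons_val_zero, Matrix.cons_val_one, one_mul]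
    rw [norm_W, norm_W, _root_.smul_apply, norm_smul, norm_W, A, _root_.add_apply,
      X_apply, _root_.smul_apply, ← wt_mul]
    have h1 := norm_add_le ((x : ℂ) * f x) ((-(I * t)) • D f x)
    rw [norm_mul, norm_smul] at h1
    have h3 : ‖(-(I * (t : ℂ)))‖ = t := by simp [abs_of_nonneg ht]
    have h4 : ‖(t : ℂ)‖ = t := by simp [abs_of_nonneg ht]
    have h5 : ‖(x : ℂ)‖ ≤ wt (1/2) x := by simpa using wt_half x
    rw [h3] at h1
    rw [h4]
    calc _ ≤ wt a x * (wt (1/2) x * ‖f x‖ + t * ‖D f x‖) := by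
            apply mul_le_mul_of_nonneg_left _ (wt_pos a x).le
            refine h1.trans ?_
            gcongr
      _ = _ := by ring

theorem step1 (t : ℝ) (f : SchwartzMap ℝ ℂ) (i : ℕ) :
    D^[i+1] (A t f) = A t (D^[i+1] f) + ((i + 1 : ℕ) : ℂ) • D^[i] f := by
  rw [A, D_iter_add, D_iter_smul, D_iter_X, A, ← Function.iterate_succ_apply,
    ← Function.iterate_succ_apply' (f := D)]
  module

theorem Nm_add_smul (f g : SchwartzMap ℝ ℂ) (n : ℕ) : Nm (f + (n : ℂ) • g) ≤ Nm f + n * Nm g := by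
  have h := Nm_le (Finset.univ : Finset (Fin 2)) (f + (n : ℂ) • g)
    ![f, (n : ℂ) • g] 1 zero_le_one (fun x => ?_)
  · have h2 : Nm ((n : ℂ) • g) ≤ n * Nm g := by
      have := Nm_le (Finset.univ : Finset (Fin 1)) ((n : ℂ) • g) ![g] n (by positivity)
        (fun x => by simp)
      simpa using this
    simp [Fin.sum_univ_two] at h
    linarith
  · simp only [Fin.sum_univ_two, Matrix.cons_val_zero, Matrix.cons_val_one, one_mul]
    exact norm_add_le _ _

theorem Nm_W_mono {a b : ℝ} (h : a ≤ b) (f : SchwartzMap ℝ ℂ) : Nm (W a f) ≤ Nm (W b f) := by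
  have := Nm_le (Finset.univ : Finset (Fin 1)) (W a f) ![W b f] 1 zero_le_one
        (fun x => by simpa [norm_W] using mul_le_mul_of_nonneg_right (wt_mono h x) (norm_nonneg _))
  simpa using this

/-- weighted sum -/
def Q (k : ℕ) (t : ℝ) (f : SchwartzMap ℝ ℂ) : ℝ :=
  ∑ j ∈ Finset.range (k + 1), t ^ j * ∑ i ∈ Finset.range (j + 1),
    Nm (W (((k - j : ℕ) : ℝ) / 2) (D^[i] f))

theorem Q_term (k : ℕ) (t : ℝ) (ht : 0 ≤ t) (f : SchwartzMap ℝ ℂ) (i j : ℕ) (hj : j ≤ k)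
    (hi : i ≤ j) : t ^ j * Nm (W (((k - j : ℕ) : ℝ) / 2) (D^[i] f)) ≤ Q k t f := by
  have h0 : ∀ j ∈ Finset.range (k+1), 0 ≤ t ^ j * ∑ i ∈ Finset.range (j + 1),
    Nm (W (((k - j : ℕ) : ℝ) / 2) (D^[i] f)) := fun j _ =>
      mul_nonneg (by positivity) (Finset.sum_nonneg fun _ _ => Nm_nonneg _)
  refine le_trans ?_ (Finset.single_le_sum h0 (Finset.mem_range.2 (Nat.lt_succ_of_le hj)))
  gcongr
  exact Finset.single_le_sum (f := fun i => Nm (W (((k - j : ℕ) : ℝ) / 2) (D^[i] f)))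
    (fun _ _ => Nm_nonneg _) (Finset.mem_range.2 (Nat.lt_succ_of_le hi))

theorem Q_step (k : ℕ) (t : ℝ) (ht : 0 ≤ t) (f : SchwartzMap ℝ ℂ) :
    Q k t (A t f) ≤ (∑ j ∈ Finset.range (k + 1), ∑ i ∈ Finset.range (j + 1), ((i : ℝ) + 2)) *
      Q (k + 1) t f := by
  rw [Q, Finset.sum_mul]
  refine Finset.sum_le_sum fun j hj => ?_
  rw [Finset.mul_sum, Finset.sum_mul]
  refine Finset.sum_le_sum fun i hi => ?_
  have hj' : j ≤ k := by simpa [Nat.lt_succ_iff] using hj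
  have hi' : i ≤ j := by simpa [Nat.lt_succ_iff] using hi
  have e1 : ((k - j : ℕ) : ℝ) / 2 + 1/2 = ((k + 1 - j : ℕ) : ℝ) / 2 := by
    rw [Nat.sub_add_comm hj']; push_cast; ring
  have e2 : ((k + 1 - (j + 1) : ℕ) : ℝ) / 2 = ((k - j : ℕ) : ℝ) / 2 := by
    rw [Nat.add_sub_add_right]
  have q1 := Q_term (k+1) t ht f i j (by omega) hi'
  have q2 := Q_term (k+1) t ht f (i+1) (j+1) (by omega) (by omega)
  rw [← e1] at q1
  rw [e2] at q2
  have htj : 0 ≤ t ^ j := by positivity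
  have s0 := step0 t ht (((k - j : ℕ) : ℝ) / 2) (D^[i] f)
  rw [← Function.iterate_succ_apply' (f := D)] at s0
  have s0' := mul_le_mul_of_nonneg_left s0 htj
  rw [pow_succ] at q2
  rcases i with _ | i
  · simp only [Function.iterate_zero, id_eq] at *
    push_cast
    nlinarith
  · rw [step1 t]
    rw [map_add, show W (((k - j : ℕ) : ℝ) / 2) (((i + 1 : ℕ) : ℂ) • D^[i] f) =
      ((i + 1 : ℕ) : ℂ) • W (((k - j : ℕ) : ℝ) / 2) (D^[i] f) by
        ext x; simp only [W_apply, _root_.smul_apply, smul_eq_mul]; ring]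
    have s1 := Nm_add_smul (W (((k - j : ℕ) : ℝ) / 2) (A t (D^[i+1] f)))
      (W (((k - j : ℕ) : ℝ) / 2) (D^[i] f)) (i + 1)
    have s2 := Nm_W_mono (show ((k - j : ℕ) : ℝ) / 2 ≤ ((k - j : ℕ) : ℝ) / 2 + 1/2 by linarith)
      (D^[i] f)
    have q3 := Q_term (k+1) t ht f i j (by omega) (by omega)
    rw [← e1] at q3
    have s3 := mul_le_mul_of_nonneg_left s1 htj
    have s4 := mul_le_mul_of_nonneg_left s2 htj
    have s5 := mul_le_mul_of_nonneg_left (s4.trans q3) (show (0:ℝ) ≤ ((i + 1 : ℕ) : ℝ) by positivity)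
    refine s3.trans ?_
    push_cast at *
    nlinarith

theorem A_iter_bound (k : ℕ) : ∃ C : ℝ, 0 ≤ C ∧ ∀ (t : ℝ), 0 ≤ t → ∀ f : SchwartzMap ℝ ℂ,
    Nm ((A t)^[k] f) ≤ C * Q k t f := by
  induction k with
  | zero =>
    refine ⟨1, zero_le_one, fun t ht f => ?_⟩
    have h : W 0 f = f := by ext x; rw [W_apply, wt_zero]; simp
    simp [Q, h]
  | succ n ih =>
    obtain ⟨C, hC, h⟩ := ih
    refine ⟨C * (∑ j ∈ Finset.range (n + 1), ∑ i ∈ Finset.range (j + 1), ((i : ℝ) + 2)),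
      mul_nonneg hC (Finset.sum_nonneg fun j _ => Finset.sum_nonneg fun i _ => by positivity),
      fun t ht f => ?_⟩
    rw [Function.iterate_succ_apply, mul_assoc]
    exact (h t ht _).trans (mul_le_mul_of_nonneg_left (Q_step n t ht f) hC)

/-- the Fourier multiplier of the free evolution -/
def mul (t : ℝ) (ξ : ℝ) : ℂ := Complex.exp (((-(2 * Real.pi ^ 2 * t) * ξ ^ 2 : ℝ) : ℂ) * I)

theorem expI_growth : (fun y : ℝ => Complex.exp ((y : ℂ) * I)).HasTemperateGrowth := by
  have hd : ∀ c : ℂ, deriv (fun y : ℝ => c * Complex.exp ((y : ℂ) * I)) =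
      fun y : ℝ => (c * I) * Complex.exp ((y : ℂ) * I) := by
    intro c
    ext y
    have h1 : HasDerivAt (fun y : ℝ => (y : ℂ) * I) (1 * I) y :=
      (HasDerivAt.ofReal_comp (hasDerivAt_id y)).mul_const I
    rw [(h1.cexp.const_mul c).deriv]; ring
  have hi : ∀ n : ℕ, iteratedDeriv n (fun y : ℝ => Complex.exp ((y : ℂ) * I)) =
      fun y : ℝ => I ^ n * Complex.exp ((y : ℂ) * I) := by
    intro n
    induction n with
    | zero => simp
    | succ n ih => rw [iteratedDeriv_succ, ih, hd, pow_succ]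
  refine ⟨?_, fun n => ⟨0, 1, fun x => ?_⟩⟩
  · exact ((Complex.ofRealCLM.contDiff).mul contDiff_const).cexp
  · rw [norm_iteratedFDeriv_eq_norm_iteratedDeriv, hi]
    simp [Complex.norm_exp_ofReal_mul_I]

theorem mul_growth (t : ℝ) : (mul t).HasTemperateGrowth := by
  have h : (fun ξ : ℝ => -(2 * Real.pi ^ 2 * t) * ξ ^ 2).HasTemperateGrowth := by
    fun_prop
  exact expI_growth.comp h

theorem norm_mul' (t ξ : ℝ) : ‖mul t ξ‖ = 1 := Complex.norm_exp_ofReal_mul_I _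

theorem mul_hasDeriv (t ξ : ℝ) :
    HasDerivAt (mul t) ((-(4 * Real.pi ^ 2 * t) * I) * ξ * mul t ξ) ξ := by
  have h0 : HasDerivAt (fun ξ : ℝ => -(2 * Real.pi ^ 2 * t) * ξ ^ 2)
      (-(2 * Real.pi ^ 2 * t) * (2 * ξ)) ξ := by
    simpa using ((hasDerivAt_id ξ).pow 2).const_mul (-(2 * Real.pi ^ 2 * t))
  have h1 := (h0.ofReal_comp.mul_const I).cexp
  refine h1.congr_deriv ?_
  rw [mul]; push_cast; ring

/-- multiplication by the multiplier -/
def M (t : ℝ) : SchwartzMap ℝ ℂ →L[ℂ] SchwartzMap ℝ ℂ := smulLeftCLM ℂ (mul t)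

theorem M_apply (t : ℝ) (f : SchwartzMap ℝ ℂ) (x : ℝ) : M t f x = mul t x * f x := by
  rw [M, smulLeftCLM_apply_apply (mul_growth t)]; simp

theorem D_M (t : ℝ) (f : SchwartzMap ℝ ℂ) :
    D (M t f) = M t (D f) + (-(4 * Real.pi ^ 2 * t) * I : ℂ) • M t (X f) := by
  ext x
  have h : ⇑(M t f) = fun x : ℝ => mul t x * f x := funext (M_apply t f)
  have h1 : HasDerivAt (fun x : ℝ => mul t x * f x) _ x :=
    (mul_hasDeriv t x).mul (f.differentiableAt.hasDerivAt)
  rw [D_apply, h, h1.deriv, _root_.add_apply, _root_.smul_apply, M_apply, M_apply, X_apply, D_apply]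
  simp only [smul_eq_mul]
  ring

theorem lineD (f : SchwartzMap ℝ ℂ) : ∂_{(1 : ℝ)} f = D f := by
  ext x
  rw [SchwartzMap.lineDerivOp_apply_eq_fderiv, D_apply, fderiv_apply_one_eq_deriv]

theorem X_eq (f : SchwartzMap ℝ ℂ) :
    smulLeftCLM ℂ (fun x : ℝ => inner ℝ x (1 : ℝ)) f = X f := by
  ext x
  rw [smulLeftCLM_apply_apply (by fun_prop), X_apply]
  simp

theorem F_D (f : SchwartzMap ℝ ℂ) : 𝓕 (D f) = (2 * Real.pi * I) • X (𝓕 f) := by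
  have := SchwartzMap.fourier_lineDerivOp_eq f (1 : ℝ)
  rwa [lineD, X_eq] at this

theorem D_F (f : SchwartzMap ℝ ℂ) : D (𝓕 f) = -(2 * Real.pi * I) • 𝓕 (X f) := by
  have := SchwartzMap.lineDerivOp_fourier_eq f (1 : ℝ)
  rw [lineD, X_eq, fourier_smul] at this
  exact this

theorem Finv_D (f : SchwartzMap ℝ ℂ) : 𝓕⁻ (D f) = -(2 * Real.pi * I) • X (𝓕⁻ f) := by
  have := SchwartzMap.fourierInv_lineDerivOp_eq f (1 : ℝ)
  rwa [lineD, X_eq] at this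

/-- the free evolution on Schwartz functions -/
def U (t : ℝ) (f : SchwartzMap ℝ ℂ) : SchwartzMap ℝ ℂ := 𝓕⁻ (M t (𝓕 f))

theorem X_U (t : ℝ) (f : SchwartzMap ℝ ℂ) : X (U t f) = U t (A t f) := by
  have h2 : (2 * Real.pi * I : ℂ) ≠ 0 := by simp [Real.pi_ne_zero]
  have h := Finv_D (M t (𝓕 f))
  rw [D_M, D_F] at h
  have h3 : X (𝓕 f) = (2 * Real.pi * I : ℂ)⁻¹ • 𝓕 (D f) := by
    rw [F_D, smul_smul, inv_mul_cancel₀ h2, one_smul]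
  rw [h3, map_smul, map_smul, fourierInv_add, fourierInv_smul, fourierInv_smul,
    fourierInv_smul] at h
  have h4 : U t (A t f) = 𝓕⁻ (M t (𝓕 (X f))) + (-(I * t)) • 𝓕⁻ (M t (𝓕 (D f))) := by
    rw [U, A, FourierTransform.fourier_add, fourier_smul, map_add, map_smul, fourierInv_add, fourierInv_smul]
  rw [h4]
  have h5 : X (U t f) = (-(2 * Real.pi * I : ℂ))⁻¹ • ((-(2 * Real.pi * I : ℂ)) • X (U t f)) := by
    rw [smul_smul, inv_mul_cancel₀ (neg_ne_zero.2 h2), one_smul]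
  rw [h5, U, ← h, smul_add, smul_smul, smul_smul, smul_smul, inv_mul_cancel₀ (neg_ne_zero.2 h2),
    one_smul]
  congr 2
  have hp : (Real.pi : ℂ) ≠ 0 := by simp [Real.pi_ne_zero]
  field_simp
  try rw [I_sq]
  try ring

theorem X_U_iter (t : ℝ) (k : ℕ) (f : SchwartzMap ℝ ℂ) (x : ℝ) :
    (x : ℂ) ^ k * U t f x = U t ((A t)^[k] f) x := by
  induction k generalizing f with
  | zero => simp
  | succ n ih =>
    rw [Function.iterate_succ_apply, ← ih, ← X_U, X_apply]; ring

theorem Nm_F (f : SchwartzMap ℝ ℂ) : Nm (𝓕 f) = Nm f := by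
  have := SchwartzMap.norm_fourier_toL2_eq f
  rwa [SchwartzMap.norm_toLp, SchwartzMap.norm_toLp] at this

theorem Nm_U (t : ℝ) (f : SchwartzMap ℝ ℂ) : Nm (U t f) = Nm f := by
  rw [← Nm_F (U t f), U, fourier_fourierInv_eq, ← Nm_F f, Nm, Nm]
  congr 1
  apply eLpNorm_congr_norm_ae
  refine Filter.Eventually.of_forall fun x => ?_
  rw [M_apply, norm_mul, norm_mul', one_mul]

theorem U_formula (t : ℝ) (f : SchwartzMap ℝ ℂ) (z : ℝ) :
    U t f z = (1 / (2 * Real.pi) : ℝ) * ∫ lam : ℝ,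
      Complex.exp (I * (z : ℂ) * (lam : ℂ) - I * (t : ℂ) * (lam : ℂ) ^ 2 / 2) *
        ∫ y : ℝ, Complex.exp (-I * (lam : ℂ) * (y : ℂ)) * f y := by
  have h := Measure.integral_comp_mul_left (fun lam : ℝ =>
      Complex.exp (I * (z : ℂ) * (lam : ℂ) - I * (t : ℂ) * (lam : ℂ) ^ 2 / 2) *
        ∫ y : ℝ, Complex.exp (-I * (lam : ℂ) * (y : ℂ)) * f y) (2 * Real.pi)
  have hpi := Real.pi_pos
  rw [abs_of_pos (by positivity), real_smul] at h
  rw [one_div, ← h, U, SchwartzMap.fourierInv_coe, Real.fourierInv_eq']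
  congr 1
  ext ξ
  rw [M_apply, SchwartzMap.fourier_coe, Real.fourier_real_eq_integral_exp_smul, mul,
    smul_eq_mul, ← mul_assoc, ← Complex.exp_add]
  congr 1
  · congr 1
    simp
    ring
  · congr 1
    ext y
    rw [smul_eq_mul]
    congr 2
    push_cast
    ring

theorem F_formula (t x₀ v : ℝ) (φ : SchwartzMap ℝ ℂ) (x : ℝ) :
    ((1 / (2 * Real.pi) : ℝ) *
      ∫ lam : ℝ, Complex.exp (I * (x : ℂ) * (lam : ℂ) - I * (t : ℂ) * (lam : ℂ) ^ 2 / 2) *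
        ∫ y : ℝ, Complex.exp (-I * (lam : ℂ) * (y : ℂ)) *
          (Complex.exp (I * (y : ℂ) * (v : ℂ)) * φ (y - x₀)) : ℂ) =
    Complex.exp (((x * v - t * v ^ 2 / 2 : ℝ) : ℂ) * I) * U t φ (x - x₀ - t * v) := by
  rw [U_formula, mul_left_comm]
  congr 1
  rw [← integral_const_mul]
  refine Eq.trans (integral_add_right_eq_self (E := ℂ) (μ := volume) _ v).symm ?_
  refine integral_congr_ae (Filter.Eventually.of_forall fun lam => ?_)
  beta_reduce
  rw [← integral_add_right_eq_self (fun y : ℝ => Complex.exp (-I * ((lam + v : ℝ) : ℂ) * (y : ℂ)) *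
          (Complex.exp (I * (y : ℂ) * (v : ℂ)) * φ (y - x₀))) x₀]
  have h : (fun y : ℝ => Complex.exp (-I * ((lam + v : ℝ) : ℂ) * ((y + x₀ : ℝ) : ℂ)) *
          (Complex.exp (I * ((y + x₀ : ℝ) : ℂ) * (v : ℂ)) * φ (y + x₀ - x₀))) =
      fun y : ℝ => Complex.exp (-I * lam * x₀) * (Complex.exp (-I * (lam : ℂ) * (y : ℂ)) * φ y) := by
    ext y
    rw [add_sub_cancel_right, ← mul_assoc, ← mul_assoc, ← Complex.exp_add, ← Complex.exp_add]
    congr 2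
    push_cast
    ring
  rw [h, integral_const_mul, ← mul_assoc, ← mul_assoc, ← Complex.exp_add, ← Complex.exp_add]
  congr 2
  push_cast
  ring

theorem main_bound (k : ℕ) (φ : SchwartzMap ℝ ℂ) (x₀ v t : ℝ) (hv : 0 < v) (ht : 0 < t)
    (hx : 2 * |x₀| / v ≤ t) :
    (eLpNorm (Set.indicator (Set.Iio (0 : ℝ)) fun x : ℝ =>
        Complex.exp (((x * v - t * v ^ 2 / 2 : ℝ) : ℂ) * I) * U t φ (x - x₀ - t * v))
        2 volume).toReal ≤ 2 ^ k * (t * v) ^ (-(k : ℝ)) * Nm ((A t)^[k] φ) := by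
  have htv : 0 < t * v := by positivity
  have hx' : 2 * |x₀| ≤ t * v := by rwa [div_le_iff₀ hv] at hx
  set c : ℝ := 2 ^ k * (t * v) ^ (-(k : ℝ)) with hc
  have hc' : c * (t * v / 2) ^ k = 1 := by
    rw [hc, Real.rpow_neg htv.le, Real.rpow_natCast, div_pow]
    field_simp
  have hc0 : 0 ≤ c := by positivity
  have h1 : eLpNorm (Set.indicator (Set.Iio (0 : ℝ)) fun x : ℝ =>
        Complex.exp (((x * v - t * v ^ 2 / 2 : ℝ) : ℂ) * I) * U t φ (x - x₀ - t * v)) 2 volume ≤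
      ENNReal.ofReal c * eLpNorm (fun x : ℝ => U t ((A t)^[k] φ) (x - (x₀ + t * v))) 2 volume := by
    refine eLpNorm_le_mul_eLpNorm_of_ae_le_mul (Filter.Eventually.of_forall fun x => ?_) 2
    by_cases hx0 : x < 0
    · rw [Set.indicator_of_mem (Set.mem_Iio.2 hx0), norm_mul, Complex.norm_exp_ofReal_mul_I, one_mul,
        ← X_U_iter, norm_mul, norm_pow, Complex.norm_real, ← sub_sub, ← mul_assoc]
      have h2 : t * v / 2 ≤ ‖x - x₀ - t * v‖ := by
        rw [Real.norm_eq_abs]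
        have := neg_abs_le x₀
        refine le_trans ?_ (neg_le_abs _)
        linarith
      refine le_mul_of_one_le_left (norm_nonneg _) ?_
      rw [← hc']
      gcongr
    · rw [Set.indicator_of_notMem (by simpa using hx0)]
      simp only [norm_zero]
      positivity
  have h3 : eLpNorm (fun x : ℝ => U t ((A t)^[k] φ) (x - (x₀ + t * v))) 2 volume =
      eLpNorm (U t ((A t)^[k] φ)) 2 volume :=
    eLpNorm_comp_measurePreserving (U t ((A t)^[k] φ)).continuous.aestronglyMeasurable
      (measurePreserving_sub_right volume (x₀ + t * v))
  rw [h3] at h1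
  have h4 := ENNReal.toReal_mono (ENNReal.mul_ne_top ENNReal.ofReal_ne_top
    ((U t ((A t)^[k] φ)).memLp 2 volume).2.ne) h1
  rw [ENNReal.toReal_mul, ENNReal.toReal_ofReal hc0] at h4
  rwa [← Nm_U t]

theorem term_eq (a : ℝ) (i : ℕ) (φ : SchwartzMap ℝ ℂ) :
    (eLpNorm (iteratedDeriv i fun x : ℝ => (((1 + x ^ 2 : ℝ) ^ a : ℝ) : ℂ) * φ x) 2 volume).toReal =
      Nm (D^[i] (W a φ)) := by
  rw [Nm, D_iter]
  congr 3
  ext x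
  rw [W_apply, wt]

theorem Q_le (k : ℕ) : ∃ C : ℝ, 0 ≤ C ∧ ∀ t : ℝ, 0 ≤ t → ∀ f : SchwartzMap ℝ ℂ,
    Q k t f ≤ C * ∑ j ∈ Finset.range (k + 1), t ^ j * ∑ i ∈ Finset.range (j + 1),
      Nm (D^[i] (W (((k - j : ℕ) : ℝ) / 2) f)) := by
  choose B hB0 hB using fun (j i : ℕ) => use1 (((k - j : ℕ) : ℝ) / 2) i
  set C := ∑ j ∈ Finset.range (k + 1), ∑ i ∈ Finset.range (j + 1), B j i with hC
  refine ⟨C, Finset.sum_nonneg fun j _ => Finset.sum_nonneg fun i _ => hB0 j i, fun t ht f => ?_⟩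
  rw [Q, Finset.mul_sum]
  refine Finset.sum_le_sum fun j hj => ?_
  rw [mul_left_comm]
  refine mul_le_mul_of_nonneg_left ?_ (by positivity)
  have h1 : ∑ i ∈ Finset.range (j + 1), B j i ≤ C :=
    Finset.single_le_sum (f := fun j => ∑ i ∈ Finset.range (j + 1), B j i)
      (fun j _ => Finset.sum_nonneg fun i _ => hB0 j i) hj
  refine le_trans ?_ (mul_le_mul_of_nonneg_right h1 (Finset.sum_nonneg fun _ _ => Nm_nonneg _))
  rw [Finset.sum_mul]
  refine Finset.sum_le_sum fun i hi => (hB j i f).trans ?_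
  refine mul_le_mul_of_nonneg_left ?_ (hB0 j i)
  refine Finset.sum_le_sum_of_subset_of_nonneg ?_ (fun _ _ _ => Nm_nonneg _)
  simp only [Finset.mem_range] at hi
  exact Finset.range_mono (by omega)

theorem second_le (k : ℕ) : ∃ C : ℝ, 0 ≤ C ∧ ∀ t : ℝ, 0 ≤ t → t ≤ 1 → ∀ f : SchwartzMap ℝ ℂ,
    ∑ j ∈ Finset.range (k + 1), t ^ j * ∑ i ∈ Finset.range (j + 1),
      Nm (D^[i] (W (((k - j : ℕ) : ℝ) / 2) f)) ≤
    C * ∑ i ∈ Finset.range (k + 1), Nm (D^[i] (W ((k : ℝ) / 2) f)) := by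
  choose B hB0 hB using fun (j i : ℕ) => use2 (((k - j : ℕ) : ℝ) / 2) ((k : ℝ) / 2)
    (by have : ((k - j : ℕ) : ℝ) ≤ k := by exact_mod_cast Nat.sub_le k j
        linarith) i
  refine ⟨∑ j ∈ Finset.range (k + 1), ∑ i ∈ Finset.range (j + 1), B j i,
    Finset.sum_nonneg fun j _ => Finset.sum_nonneg fun i _ => hB0 j i, fun t ht ht1 f => ?_⟩
  rw [Finset.sum_mul]
  refine Finset.sum_le_sum fun j hj => ?_
  refine (mul_le_of_le_one_left (Finset.sum_nonneg fun _ _ => Nm_nonneg _)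
    (pow_le_one₀ ht ht1)).trans ?_
  rw [Finset.sum_mul]
  refine Finset.sum_le_sum fun i hi => (hB j i f).trans ?_
  refine mul_le_mul_of_nonneg_left ?_ (hB0 j i)
  refine Finset.sum_le_sum_of_subset_of_nonneg ?_ (fun _ _ _ => Nm_nonneg _)
  simp only [Finset.mem_range] at hi hj
  exact Finset.range_mono (by omega)

end

/-- Stationary-phase/integration-by-parts bound: for `φ` Schwartz, `v > 0`,
`0 < t ≤ 1` with `2|x₀|/v ≤ t`, the free Schrödinger evolution
`e^{−itH₀}[e^{ixv}φ(x−x₀)]` (realized by its Fourier-integral formula) restricted to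
`x < 0` satisfies, for every `k ≥ 0`,
`‖·‖_{L²} ≤ c_k (tv)^{−k} Σ_{j=0}^{k} t^j ‖⟨x⟩^{k−j}φ‖_{H^j} ≤ c_k (tv)^{−k} ‖⟨x⟩^k φ‖_{H^k}`,
where the `H^j` norm is `Σ_{i=0}^{j} ‖∂^i f‖_{L²}` and `⟨x⟩ = (1+x²)^{1/2}`. -/
theorem stmt_15 (k : ℕ) :
    ∃ c : ℝ, 0 < c ∧
      ∀ (φ : SchwartzMap ℝ ℂ) (x₀ v t : ℝ), 0 < v → 0 < t → t ≤ 1 → 2 * |x₀| / v ≤ t →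
        (eLpNorm
              (Set.indicator (Set.Iio (0 : ℝ)) fun x : ℝ =>
                (1 / (2 * Real.pi) : ℝ) *
                  ∫ lam : ℝ,
                    Complex.exp (I * (x : ℂ) * (lam : ℂ) - I * (t : ℂ) * (lam : ℂ) ^ 2 / 2) *
                      ∫ y : ℝ,
                        Complex.exp (-I * (lam : ℂ) * (y : ℂ)) *
                          (Complex.exp (I * (y : ℂ) * (v : ℂ)) * φ (y - x₀)))
              2 volume).toReal ≤
            c * (t * v) ^ (-(k : ℝ)) *
              ∑ j ∈ Finset.range (k + 1), t ^ j *
                ∑ i ∈ Finset.range (j + 1),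
                  (eLpNorm
                      (iteratedDeriv i fun x : ℝ =>
                        (((1 + x ^ 2 : ℝ) ^ (((k - j : ℕ) : ℝ) / 2) : ℝ) : ℂ) * φ x)
                      2 volume).toReal ∧
          (∑ j ∈ Finset.range (k + 1), t ^ j *
              ∑ i ∈ Finset.range (j + 1),
                (eLpNorm
                    (iteratedDeriv i fun x : ℝ =>
                      (((1 + x ^ 2 : ℝ) ^ (((k - j : ℕ) : ℝ) / 2) : ℝ) : ℂ) * φ x)
                    2 volume).toReal) ≤
            c * ∑ i ∈ Finset.range (k + 1),
              (eLpNorm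
                  (iteratedDeriv i fun x : ℝ =>
                    (((1 + x ^ 2 : ℝ) ^ ((k : ℝ) / 2) : ℝ) : ℂ) * φ x)
                  2 volume).toReal := by
  obtain ⟨C1, hC1, h1⟩ := A_iter_bound k
  obtain ⟨C2, hC2, h2⟩ := Q_le k
  obtain ⟨C3, hC3, h3⟩ := second_le k
  refine ⟨2 ^ k * (C1 * C2) + C3 + 1, by positivity, fun φ x₀ v t hv ht ht1 hx => ?_⟩
  simp only [term_eq, F_formula]
  constructor
  · refine (main_bound k φ x₀ v t hv ht hx).trans ?_
    have hS : 0 ≤ ∑ j ∈ Finset.range (k + 1), t ^ j * ∑ i ∈ Finset.range (j + 1),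
        Nm (D^[i] (W (((k - j : ℕ) : ℝ) / 2) φ)) :=
      Finset.sum_nonneg fun j _ => mul_nonneg (by positivity)
        (Finset.sum_nonneg fun _ _ => Nm_nonneg _)
    have h4 := (h1 t ht.le φ).trans (mul_le_mul_of_nonneg_left (h2 t ht.le φ) hC1)
    have hp : 0 ≤ (t * v) ^ (-(k : ℝ)) := by positivity
    refine (mul_le_mul_of_nonneg_left h4 (by positivity)).trans ?_
    have h5 : 0 ≤ (C3 + 1) * ((t * v) ^ (-(k : ℝ)) *
        ∑ j ∈ Finset.range (k + 1), t ^ j * ∑ i ∈ Finset.range (j + 1),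
        Nm (D^[i] (W (((k - j : ℕ) : ℝ) / 2) φ))) := by positivity
    linarith
  · refine (h3 t ht.le ht1 φ).trans ?_
    refine mul_le_mul_of_nonneg_right ?_ (Finset.sum_nonneg fun _ _ => Nm_nonneg _)
    have : 0 ≤ 2 ^ k * (C1 * C2) := by positivity
    linarith
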